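/- Let Δ be the set of m ∈ ℝ⁵ with m₁ ≥ m₂ ≥ m₃ ≥ m₄ ≥ m₅ > 0, mᵢ < 1/3 for all i, ∑ᵢ mᵢ = 1, and mᵢ + mⱼ ≠ 1/3 for all i < j. For m ∈ Δ set S(m) = { {i,j} : i ≠ j, mᵢ + mⱼ < 1/3 }. Then the image of the map m ↦ S(m) on Δ is exactly the six-element family { ∅, {{4,5}}, {{3,5},{4,5}}, {{2,5},{3,5},{4,5}}, {{3,4},{3,5},{4,5}}, {{1,5},{2,5},{3,5},{4,5}} }. -/

import Mathlib

/-- The set of admissible polarizations for `(ℙ²)⁵`: decreasing positive weights,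
each below `1/3`, summing to `1`, with no pair of weights summing to exactly `1/3`. -/
def Delta5 : Set (Fin 5 → ℝ) :=
  {m | (∀ i j : Fin 5, i ≤ j → m j ≤ m i) ∧ (∀ i, 0 < m i) ∧ (∀ i, m i < 1/3) ∧
    (∑ i, m i = 1) ∧ (∀ i j : Fin 5, i < j → m i + m j ≠ 1/3)}

/-- The family of two-element index sets whose weight sum is below `1/3`. -/
def S5 (m : Fin 5 → ℝ) : Set (Finset (Fin 5)) :=
  {K | ∃ i j : Fin 5, i ≠ j ∧ K = {i, j} ∧ m i + m j < 1/3}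

/-- For `m ∈ Delta5` only the pairs `{i, 4}` and `{2, 3}` can have weight sum below `1/3`. -/
theorem mem_S5_iff {m : Fin 5 → ℝ} (hm : m ∈ Delta5) (K : Finset (Fin 5)) :
    K ∈ S5 m ↔ (K = {0, 4} ∧ m 0 + m 4 < 1/3) ∨ (K = {1, 4} ∧ m 1 + m 4 < 1/3) ∨
      (K = {2, 4} ∧ m 2 + m 4 < 1/3) ∨ (K = {3, 4} ∧ m 3 + m 4 < 1/3) ∨
      (K = {2, 3} ∧ m 2 + m 3 < 1/3) := by
  obtain ⟨hanti, -, hlt, hsum, -⟩ := hm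
  rw [Fin.sum_univ_five] at hsum
  have h01 := hanti 0 1 (by decide)
  have h12 := hanti 1 2 (by decide)
  have h23 := hanti 2 3 (by decide)
  have h34 := hanti 3 4 (by decide)
  have h0 := hlt 0
  constructor
  · rintro ⟨i, j, hij, rfl, h⟩
    wlog hlt' : i < j generalizing i j
    · rw [Finset.pair_comm]
      exact this j i hij.symm (by linarith) (lt_of_le_of_ne (not_lt.mp hlt') hij.symm)
    fin_cases i <;> fin_cases j <;> simp at hlt' h <;>
      first
      | (exfalso; linarith)
      | simp [h]
  · rintro (⟨rfl, h⟩ | ⟨rfl, h⟩ | ⟨rfl, h⟩ | ⟨rfl, h⟩ | ⟨rfl, h⟩)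
    exacts [⟨0, 4, by decide, rfl, h⟩, ⟨1, 4, by decide, rfl, h⟩, ⟨2, 4, by decide, rfl, h⟩,
      ⟨3, 4, by decide, rfl, h⟩, ⟨2, 3, by decide, rfl, h⟩]

/-- Membership in `Delta5` of an explicit vector, in terms of finitely many inequalities. -/
theorem vec_mem_Delta5 {a b c d e : ℝ} (hab : b ≤ a) (hbc : c ≤ b) (hcd : d ≤ c) (hde : e ≤ d)
    (he : 0 < e) (ha : a < 1/3) (hsum : a + b + c + d + e = 1)
    (hae : a + e ≠ 1/3) (hbe : b + e ≠ 1/3) (hce : c + e ≠ 1/3) (hde' : d + e ≠ 1/3)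
    (hcd' : c + d ≠ 1/3) : ![a, b, c, d, e] ∈ Delta5 := by
  have hbd : 1/3 < b + d := by linarith
  refine ⟨?_, ?_, ?_, ?_, ?_⟩
  · refine fun i j hij => (Fin.antitone_iff_succ_le.mpr fun k => ?_) hij
    fin_cases k <;> assumption
  · intro i
    fin_cases i <;> simp <;> linarith
  · intro i
    fin_cases i <;> simp <;> linarith
  · simpa [Fin.sum_univ_five] using hsum
  · intro i j hij
    fin_cases i <;> fin_cases j <;> first
      | exact absurd hij (by decide)
      | assumption
      | exact ne_of_gt (by simp; linarith)

/-- Indices here are `0,…,4` corresponding to the paper's `1,…,5`. -/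
theorem stmt_1 :
    S5 '' Delta5 =
      {∅,
       {({3, 4} : Finset (Fin 5))},
       {({2, 4} : Finset (Fin 5)), {3, 4}},
       {({1, 4} : Finset (Fin 5)), {2, 4}, {3, 4}},
       {({2, 3} : Finset (Fin 5)), {2, 4}, {3, 4}},
       {({0, 4} : Finset (Fin 5)), {1, 4}, {2, 4}, {3, 4}}} := by
  apply Set.Subset.antisymm
  · rintro _ ⟨m, hm, rfl⟩
    have key := mem_S5_iff hm
    obtain ⟨hanti, -, hlt, hsum, -⟩ := hm
    rw [Fin.sum_univ_five] at hsum
    have h01 := hanti 0 1 (by decide)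
    have h12 := hanti 1 2 (by decide)
    have h23 := hanti 2 3 (by decide)
    have h34 := hanti 3 4 (by decide)
    have h0 := hlt 0
    simp only [Set.mem_insert_iff, Set.mem_singleton_iff, Set.ext_iff, key,
      Set.mem_empty_iff_false]
    by_cases h34' : m 3 + m 4 < 1/3
    · by_cases h24 : m 2 + m 4 < 1/3
      · by_cases h23' : m 2 + m 3 < 1/3
        · have h14 : ¬ m 1 + m 4 < 1/3 := by intro h; linarith
          have h04 : ¬ m 0 + m 4 < 1/3 := by intro h; linarith
          right; right; right; right; left
          intro K
          simp only [h34', h24, h23', h14, h04]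
          tauto
        · by_cases h14 : m 1 + m 4 < 1/3
          · by_cases h04 : m 0 + m 4 < 1/3
            · right; right; right; right; right
              intro K
              simp only [h34', h24, h23', h14, h04]
              tauto
            · right; right; right; left
              intro K
              simp only [h34', h24, h23', h14, h04]
              tauto
          · have h04 : ¬ m 0 + m 4 < 1/3 := by intro h; linarith
            right; right; left
            intro K
            simp only [h34', h24, h23', h14, h04]
            tauto
      · have h23' : ¬ m 2 + m 3 < 1/3 := by intro h; linarith
        have h14 : ¬ m 1 + m 4 < 1/3 := by intro h; linarith
        have h04 : ¬ m 0 + m 4 < 1/3 := by intro h; linarith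
        right; left
        intro K
        simp only [h34', h24, h23', h14, h04]
        tauto
    · have h24 : ¬ m 2 + m 4 < 1/3 := by intro h; linarith
      have h23' : ¬ m 2 + m 3 < 1/3 := by intro h; linarith
      have h14 : ¬ m 1 + m 4 < 1/3 := by intro h; linarith
      have h04 : ¬ m 0 + m 4 < 1/3 := by intro h; linarith
      left
      intro K
      simp only [h34', h24, h23', h14, h04]
      tauto
  · have realize : ∀ {a b c d e : ℝ} {T : Set (Finset (Fin 5))},
        ![a, b, c, d, e] ∈ Delta5 →
        (∀ K, (K = {0, 4} ∧ a + e < 1/3) ∨ (K = {1, 4} ∧ b + e < 1/3) ∨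
          (K = {2, 4} ∧ c + e < 1/3) ∨ (K = {3, 4} ∧ d + e < 1/3) ∨
          (K = {2, 3} ∧ c + d < 1/3) ↔ K ∈ T) → T ∈ S5 '' Delta5 :=
      fun hm hT => ⟨_, hm, Set.ext fun K => (mem_S5_iff hm K).trans (hT K)⟩
    rintro _ (rfl | rfl | rfl | rfl | rfl | rfl)
    · refine realize (a := 1/5) (b := 1/5) (c := 1/5) (d := 1/5) (e := 1/5)
        (by apply vec_mem_Delta5 <;> norm_num) fun K => ?_
      norm_num
    · refine realize (a := 7/30) (b := 7/30) (c := 7/30) (d := 3/20) (e := 3/20)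
        (by apply vec_mem_Delta5 <;> norm_num) fun K => ?_
      norm_num
    · refine realize (a := 13/50) (b := 13/50) (c := 9/50) (d := 9/50) (e := 3/25)
        (by apply vec_mem_Delta5 <;> norm_num) fun K => ?_
      norm_num
    · refine realize (a := 3/10) (b := 1/5) (c := 1/5) (d := 1/5) (e := 1/10)
        (by apply vec_mem_Delta5 <;> norm_num) fun K => ?_
      norm_num
    · refine realize (a := 29/100) (b := 29/100) (c := 7/50) (d := 7/50) (e := 7/50)
        (by apply vec_mem_Delta5 <;> norm_num) fun K => ?_
      norm_num
      tauto
    · refine realize (a := 6/25) (b := 6/25) (c := 6/25) (d := 6/25) (e := 1/25)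
        (by apply vec_mem_Delta5 <;> norm_num) fun K => ?_
      norm_num
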